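/- Fix ε > 0 and suppose the revealing probabilities satisfy limsup_{t→∞} t·p_t ≤ (1−ε)·((a+b)/b)·κ*(a,b). Then P(MAP(Z_1, ..., Z_{t-1}, X_t) ≠ θ) = ω(1/t) as t → ∞, i.e., t·P(MAP(Z_1, ..., Z_{t-1}, X_t) ≠ θ) → ∞. -/

import Mathlib

open MeasureTheory ProbabilityTheory Filter Asymptotics
open scoped ENNReal NNReal

noncomputable section

/-- The constant `κ*(a,b)` from the paper. -/
def kappaStar (a b : ℝ) : ℝ :=
  1 / (1 + (a / b - 1) / Real.log (a / b) *
      (Real.log ((a / b - 1) / Real.log (a / b)) - 1))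

/-- The signal distribution: `signalProb a b i x = P(X_t = x | θ = i)`,
equal to `a/(a+b)` if `x = i` and `b/(a+b)` otherwise. -/
def signalProb (a b : ℝ) (i x : ℕ) : ℝ :=
  if x = i then a / (a + b) else b / (a + b)

/-- The D-likelihood `D_i^t = Q_i^t(Z_1,…,Z_{t-1},X_t)`: the conditional probability, given
`θ = i`, of observing the actions `Z_1,…,Z_{t-1}` and private signal `X_t` that actually
occurred at the sample point `ω`. -/
def Dlike {Ω : Type*} [MeasurableSpace Ω] (μ : Measure Ω) (θ : Ω → ℕ)
    (X Z : ℕ → Ω → ℕ) (t : ℕ) (i : ℕ) (ω : Ω) : ℝ :=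
  (μ {ω' | θ ω' = i ∧ (∀ s ∈ Finset.Icc 1 (t - 1), Z s ω' = Z s ω) ∧ X t ω' = X t ω}).toReal
    / (μ {ω' | θ ω' = i}).toReal

/-- The maximum a posteriori estimate of `θ` given `(Z_1,…,Z_{t-1},X_t)`, with ties broken
by following the private signal `X_t`.  (The prior on `θ` is uniform, so comparing the
posteriors amounts to comparing `D_1^t` and `D_2^t`.) -/
def mapEst {Ω : Type*} [MeasurableSpace Ω] (μ : Measure Ω) (θ : Ω → ℕ)
    (X Z : ℕ → Ω → ℕ) (t : ℕ) (ω : Ω) : ℕ :=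
  if Dlike μ θ X Z t 2 ω < Dlike μ θ X Z t 1 ω then 1
  else if Dlike μ θ X Z t 1 ω < Dlike μ θ X Z t 2 ω then 2
  else X t ω

/-- The L-likelihood `L_i^t = P_i(Z_1 = z_1, …, Z_t = z_t)` evaluated at the observed
actions. -/
def Llike {Ω : Type*} [MeasurableSpace Ω] (μ : Measure Ω) (θ : Ω → ℕ)
    (Z : ℕ → Ω → ℕ) (t : ℕ) (i : ℕ) (ω : Ω) : ℝ :=
  (μ {ω' | θ ω' = i ∧ ∀ s ∈ Finset.Icc 1 t, Z s ω' = Z s ω}).toReal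
    / (μ {ω' | θ ω' = i}).toReal

/-- The likelihood ratio `R_t = L_1^t / L_2^t` (with `R_0 = 1`). -/
def LR {Ω : Type*} [MeasurableSpace Ω] (μ : Measure Ω) (θ : Ω → ℕ)
    (Z : ℕ → Ω → ℕ) (t : ℕ) (ω : Ω) : ℝ :=
  Llike μ θ Z t 1 ω / Llike μ θ Z t 2 ω

/-- The sequential decision making model with Bayesians and revealers.
`θ` is the state of the world, uniform on `{1,2}`; given `θ`, the signals `X_t` are i.i.d.
with `P(X_t = θ | θ) = a/(a+b)`, the revealing indicators `I_t` are independent Bernoulli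
with `E[I_t] = p_t`, independent of everything else (this is the content of `joint`), and
the actions are `Z_t = X_t` if `I_t = 1` and `Z_t = MAP(Z_1,…,Z_{t-1},X_t)` if `I_t = 0`
(field `dynamics`).  Players are indexed by `t ≥ 1`; `Z 0` is set to the constant `1` for
definiteness. -/
structure IsCascade (a b : ℝ) (p : ℕ → ℝ) {Ω : Type*} [MeasurableSpace Ω]
    (μ : Measure Ω) (θ : Ω → ℕ) (X I Z : ℕ → Ω → ℕ) : Prop where
  prob : IsProbabilityMeasure μ
  theta_meas : Measurable θ
  X_meas : ∀ t, Measurable (X t)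
  I_meas : ∀ t, Measurable (I t)
  Z_meas : ∀ t, Measurable (Z t)
  p_mem : ∀ t : ℕ, 1 ≤ t → p t ∈ Set.Icc (0 : ℝ) 1
  theta_range : ∀ ω, θ ω = 1 ∨ θ ω = 2
  X_range : ∀ t ω, X t ω = 1 ∨ X t ω = 2
  I_range : ∀ t ω, I t ω = 0 ∨ I t ω = 1
  Z_zero : ∀ ω, Z 0 ω = 1
  joint : ∀ i : ℕ, i = 1 ∨ i = 2 → ∀ s : Finset ℕ, (∀ t ∈ s, 1 ≤ t) →
    ∀ x c : ℕ → ℕ, (∀ t, x t = 1 ∨ x t = 2) → (∀ t, c t = 0 ∨ c t = 1) →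
    (μ {ω | θ ω = i ∧ ∀ t ∈ s, X t ω = x t ∧ I t ω = c t}).toReal
      = 1 / 2 * ∏ t ∈ s, signalProb a b i (x t) * (if c t = 1 then p t else 1 - p t)
  dynamics : ∀ t : ℕ, 1 ≤ t → ∀ ω,
    Z t ω = if I t ω = 1 then X t ω else mapEst μ θ X Z t ω

/-- The error probability `E_t = P(Z_t ≠ θ)`. -/
def errProb {Ω : Type*} [MeasurableSpace Ω] (μ : Measure Ω) (θ : Ω → ℕ)
    (Z : ℕ → Ω → ℕ) (t : ℕ) : ℝ :=
  (μ {ω | Z t ω ≠ θ ω}).toReal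

/-- The probability that the MAP estimator is wrong at time `t`:
`P(MAP(Z_1,…,Z_{t-1},X_t) ≠ θ)`. -/
def mapErr {Ω : Type*} [MeasurableSpace Ω] (μ : Measure Ω) (θ : Ω → ℕ)
    (X Z : ℕ → Ω → ℕ) (t : ℕ) : ℝ :=
  (μ {ω | mapEst μ θ X Z t ω ≠ θ ω}).toReal

/-- One-step multiplier. -/
def mulM (ρ q s : ℝ) : ℝ := (1 - q) ^ s * (1 - ρ * q) ^ (1 - s) + q ^ s * (ρ * q) ^ (1 - s)

def gg (ρ : ℝ) : ℝ := (ρ - 1) / Real.log ρ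
def bet (ρ : ℝ) : ℝ := 1 + gg ρ * (Real.log (gg ρ) - 1)

lemma gg_gt {ρ : ℝ} (h : 1 < ρ) : 1 < gg ρ := by
  have := Real.log_pos h
  rw [gg, lt_div_iff₀ this]
  have := Real.log_lt_sub_one_of_pos (by linarith) h.ne'
  linarith

lemma gg_lt {ρ : ℝ} (h : 1 < ρ) : gg ρ < ρ := by
  have hl := Real.log_pos h
  have h0 : 0 < ρ := by linarith
  rw [gg, div_lt_iff₀ hl]
  have h1 : ρ⁻¹ ≠ 1 := by
    intro h2
    rw [inv_eq_one] at h2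
    linarith
  have := Real.log_lt_sub_one_of_pos (x := ρ⁻¹) (by positivity) h1
  rw [Real.log_inv] at this
  have h3 : ρ * ρ⁻¹ = 1 := mul_inv_cancel₀ h0.ne'
  nlinarith

lemma bet_pos {ρ : ℝ} (h : 1 < ρ) : 0 < bet ρ := by
  have h1 := gg_gt h
  have h0 : 0 < gg ρ := by linarith
  have h2 : (gg ρ)⁻¹ ≠ 1 := by
    intro h2
    rw [inv_eq_one] at h2
    linarith
  have := Real.log_lt_sub_one_of_pos (x := (gg ρ)⁻¹) (by positivity) h2
  rw [Real.log_inv] at this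
  have h3 : gg ρ * (gg ρ)⁻¹ = 1 := mul_inv_cancel₀ h0.ne'
  unfold bet
  nlinarith

/-- Exponent function. -/
def psi (ρ s : ℝ) : ℝ := (ρ - 1) * s - ρ + ρ ^ (1 - s)

def sst (ρ : ℝ) : ℝ := 1 - Real.log (gg ρ) / Real.log ρ

lemma sst_pos {ρ : ℝ} (h : 1 < ρ) : 0 < sst ρ := by
  have hl := Real.log_pos h
  have h1 := gg_gt h
  have := Real.log_lt_log (by linarith) (gg_lt h)
  rw [sst, sub_pos, div_lt_one hl]; exact this

lemma sst_lt {ρ : ℝ} (h : 1 < ρ) : sst ρ < 1 := by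
  have hl := Real.log_pos h
  have := Real.log_pos (gg_gt h)
  have : 0 < Real.log (gg ρ) / Real.log ρ := by positivity
  rw [sst]; linarith

lemma psi_sst {ρ : ℝ} (h : 1 < ρ) (d : ℝ) :
    psi ρ (sst ρ + d) = - bet ρ + gg ρ * (Real.log ρ * d + Real.exp (-(Real.log ρ * d)) - 1) := by
  have hl := Real.log_pos h
  have h0 : 0 < ρ := by linarith
  have h1 := gg_gt h
  have e1 : ρ ^ (1 - (sst ρ + d)) = gg ρ * Real.exp (-(Real.log ρ * d)) := by
    rw [Real.rpow_def_of_pos h0]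
    have : Real.log ρ * (1 - (sst ρ + d)) = Real.log (gg ρ) + -(Real.log ρ * d) := by
      rw [sst]; field_simp; ring
    rw [this, Real.exp_add, Real.exp_log (by linarith)]
  have e2 : ρ - 1 = gg ρ * Real.log ρ := by rw [gg]; field_simp
  have e3 : (ρ - 1) * sst ρ = ρ - 1 - gg ρ * Real.log (gg ρ) := by
    rw [sst, mul_sub, mul_one, gg]; field_simp
  rw [psi, e1, bet, mul_add, e3]
  rw [e2]
  linarith

lemma mulM_le {ρ q s : ℝ} (h : 1 < ρ) (hs0 : 0 < s) (hs1 : s < 1) (hq : 0 ≤ q) (hq1 : ρ * q ≤ 1) :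
    mulM ρ q s ≤ 1 + q * psi ρ s := by
  have hq2 : q ≤ 1 := by nlinarith
  have := Real.geom_mean_le_arith_mean2_weighted hs0.le (by linarith : 0 ≤ 1 - s)
    (by linarith : 0 ≤ 1 - q) (by linarith : 0 ≤ 1 - ρ * q) (by ring)
  have e : q ^ s * (ρ * q) ^ (1 - s) = ρ ^ (1 - s) * q := by
    rw [Real.mul_rpow (by linarith) hq]
    have : q ^ s * q ^ (1 - s) = q := by
      rw [← Real.rpow_add_of_nonneg hq hs0.le (by linarith)]; simp
    linear_combination ρ ^ (1 - s) * this
  rw [mulM, e, psi]; nlinarith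

lemma mulM_ge {ρ s β : ℝ} (h : 1 < ρ) (hs0 : 0 < s) (hs1 : s < 1) (hβ : -β < psi ρ s) :
    ∃ q0 > 0, ∀ q, 0 ≤ q → q ≤ q0 → Real.exp (-β * q) ≤ mulM ρ q s := by
  have e : ∀ q, 0 ≤ q → q ^ s * (ρ * q) ^ (1 - s) = ρ ^ (1 - s) * q := by
    intro q hq
    rw [Real.mul_rpow (by linarith) hq]
    have : q ^ s * q ^ (1 - s) = q := by
      rw [← Real.rpow_add_of_nonneg hq hs0.le (by linarith)]; simp
    linear_combination ρ ^ (1 - s) * this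
  have hd : HasDerivAt (fun q : ℝ => (1 - q) ^ s * (1 - ρ * q) ^ (1 - s) + ρ ^ (1 - s) * q
      - Real.exp (-β * q)) (psi ρ s + β) 0 := by
    have h1 : HasDerivAt (fun q : ℝ => 1 - q) (-1) 0 := by
      simpa using (hasDerivAt_id (0:ℝ)).const_sub 1
    have h2 : HasDerivAt (fun q : ℝ => 1 - ρ * q) (-ρ) 0 := by
      simpa using ((hasDerivAt_id (0:ℝ)).const_mul ρ).const_sub 1
    have h3 : HasDerivAt (fun q : ℝ => ρ ^ (1 - s) * q) (ρ ^ (1 - s)) 0 := by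
      simpa using ((hasDerivAt_id (0:ℝ)).const_mul (ρ ^ (1 - s)))
    have h4 : HasDerivAt (fun q : ℝ => -β * q) (-β) 0 := by
      simpa using ((hasDerivAt_id (0:ℝ)).const_mul (-β))
    have := (((h1.rpow_const (p := s) (Or.inl (by norm_num))).mul
      (h2.rpow_const (p := 1 - s) (Or.inl (by norm_num)))).add h3).sub h4.exp
    refine this.congr_deriv ?_
    simp [psi]; ring
  have hs := hasDerivAt_iff_tendsto_slope.1 hd
  have hs' := hs.mono_left (nhdsWithin_mono (0:ℝ) (s := Set.Ioi 0) (fun x hx => ne_of_gt hx))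
  have hev := hs'.eventually (lt_mem_nhds (by linarith : (0:ℝ) < psi ρ s + β))
  rw [eventually_nhdsWithin_iff, Metric.eventually_nhds_iff] at hev
  obtain ⟨δ, hδ, hev⟩ := hev
  refine ⟨δ / 2, by linarith, fun q hq hq2 => ?_⟩
  rcases hq.eq_or_lt with rfl | hq'
  · rw [mulM, e 0 le_rfl]; simp
  have := hev (y := q) (by rw [Real.dist_eq, sub_zero, abs_of_pos hq']; linarith) hq'
  rw [slope_def_field] at this
  simp only [sub_zero, mul_zero, Real.exp_zero, Real.one_rpow] at this
  rw [lt_div_iff₀ hq'] at this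
  rw [mulM, e q hq]
  linarith

lemma exists_params {ρ κ : ℝ} (h : 1 < ρ) (hκ : 0 < κ) (hκβ : κ * bet ρ < 1) :
    ∃ s0 s1 s2 τ q0 : ℝ, 0 < s0 ∧ s0 < s1 ∧ s1 < s2 ∧ s2 < 1 ∧ 0 < τ ∧ 0 < q0 ∧
      κ * (bet ρ + τ * (s1 / (s2 - s1))) < 1 ∧
      ∀ q, 0 ≤ q → q ≤ q0 → ρ * q ≤ 1 ∧ mulM ρ q s0 ≤ Real.exp (-bet ρ * q) ∧
        Real.exp (-bet ρ * q) ≤ mulM ρ q s1 ∧ mulM ρ q s2 ≤ Real.exp ((τ - bet ρ) * q) := by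
  have hl := Real.log_pos h
  have hg := gg_gt h
  have hs0 := sst_pos h
  have hs1 := sst_lt h
  obtain ⟨d, hd0, hd1, hd2, hd3⟩ : ∃ d : ℝ, 0 < d ∧ sst ρ + 2 * d < 1 ∧ Real.log ρ * (2 * d) ≤ 1 ∧
      κ * (4 * gg ρ * Real.log ρ ^ 2 * d) < 1 - κ * bet ρ := by
    have hC : 0 < κ * (4 * gg ρ * Real.log ρ ^ 2) := by positivity
    refine ⟨min ((1 - sst ρ) / 4) (min (1 / (2 * Real.log ρ)) ((1 - κ * bet ρ) / (2 * (κ * (4 * gg ρ * Real.log ρ ^ 2))))), ?_, ?_, ?_, ?_⟩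
    · refine lt_min (by linarith) (lt_min (by positivity) (div_pos (by linarith) (by positivity)))
    · have := min_le_left ((1 - sst ρ) / 4) (min (1 / (2 * Real.log ρ)) ((1 - κ * bet ρ) / (2 * (κ * (4 * gg ρ * Real.log ρ ^ 2)))))
      linarith
    · have := (min_le_right ((1 - sst ρ) / 4) (min (1 / (2 * Real.log ρ)) ((1 - κ * bet ρ) / (2 * (κ * (4 * gg ρ * Real.log ρ ^ 2)))))).trans (min_le_left _ _)
      rw [le_div_iff₀ (by positivity)] at this
      linarith
    · have := (min_le_right ((1 - sst ρ) / 4) (min (1 / (2 * Real.log ρ)) ((1 - κ * bet ρ) / (2 * (κ * (4 * gg ρ * Real.log ρ ^ 2)))))).trans (min_le_right _ _)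
      rw [le_div_iff₀ (by positivity)] at this
      linarith
  set β := bet ρ with hβ
  have ht : ∀ x : ℝ, 0 < x → 0 < x + Real.exp (-x) - 1 := by
    intro x hx
    have := Real.add_one_lt_exp (x := -x) (by linarith)
    linarith
  have p0 : psi ρ (sst ρ) = -β := by simpa using psi_sst h 0
  have p1 : -β < psi ρ (sst ρ + d) := by
    rw [psi_sst h]
    have := mul_pos (by linarith : 0 < gg ρ) (ht (Real.log ρ * d) (by positivity))
    linarith
  obtain ⟨q1, hq1, hq1'⟩ := mulM_ge h (by linarith) (by linarith) p1
  set τ := gg ρ * (Real.log ρ * (2 * d) + Real.exp (-(Real.log ρ * (2 * d))) - 1) with hτ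
  have hτ0 : 0 < τ := mul_pos (by linarith : 0 < gg ρ) (ht (Real.log ρ * (2 * d)) (by positivity))
  have hτ1 : τ ≤ gg ρ * (Real.log ρ * (2 * d)) ^ 2 := by
    have h5 : |(-(Real.log ρ * (2 * d)))| ≤ 1 := by
      rw [abs_neg, abs_of_pos (by positivity)]; exact hd2
    have := (abs_le.1 (Real.abs_exp_sub_one_sub_id_le h5)).2
    rw [hτ]
    refine mul_le_mul_of_nonneg_left ?_ (by linarith)
    nlinarith
  refine ⟨sst ρ, sst ρ + d, sst ρ + 2 * d, τ, min q1 (1 / ρ), hs0, by linarith, by linarith, hd1, hτ0,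
    lt_min hq1 (by positivity), ?_, ?_⟩
  · have e : sst ρ + 2 * d - (sst ρ + d) = d := by ring
    rw [e]
    have : τ * ((sst ρ + d) / d) ≤ 4 * gg ρ * Real.log ρ ^ 2 * d := by
      rw [mul_div_assoc', div_le_iff₀ hd0]
      calc τ * (sst ρ + d) ≤ τ * 1 := by gcongr; linarith
        _ ≤ _ := by nlinarith
    nlinarith
  · intro q hq hq0
    have hq2 : ρ * q ≤ 1 := by
      have := hq0.trans (min_le_right _ _)
      rw [le_div_iff₀ (by linarith)] at this; linarith
    refine ⟨hq2, ?_, hq1' q hq (hq0.trans (min_le_left _ _)), ?_⟩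
    · have := mulM_le h hs0 hs1 hq hq2
      rw [p0] at this
      have h6 := Real.add_one_le_exp (-β * q)
      linarith
    · have := mulM_le h (by linarith) hd1 hq hq2
      rw [psi_sst h] at this
      have h6 := Real.add_one_le_exp ((τ - β) * q)
      linarith

/-- Homogeneous weight. -/
def WW (ρ s x y : ℝ) : ℝ := (x / ρ) ^ s * y ^ (1 - s)

lemma WW_nonneg {ρ s x y : ℝ} (h : 1 < ρ) (hx : 0 ≤ x) (hy : 0 ≤ y) : 0 ≤ WW ρ s x y := by
  unfold WW; have : 0 < ρ := by linarith
  positivity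

lemma WW_step {ρ s x y q : ℝ} (h : 1 < ρ) (hx : 0 ≤ x) (hy : 0 ≤ y)
    (hq : 0 ≤ q) (hq1 : ρ * q ≤ 1) :
    WW ρ s (x * (1 - q)) (y * (1 - ρ * q)) + WW ρ s (x * q) (y * (ρ * q))
      = mulM ρ q s * WW ρ s x y := by
  have hρ : 0 < ρ := by linarith
  have hq2 : q ≤ 1 := by nlinarith
  unfold WW mulM
  rw [mul_div_right_comm, mul_div_right_comm, Real.mul_rpow (by positivity) (by linarith),
    Real.mul_rpow hy (by linarith), Real.mul_rpow (by positivity) hq,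
    Real.mul_rpow hy (by positivity)]
  ring

lemma WW_le {ρ s0 s1 x y : ℝ} (h : 1 < ρ) (h0 : 0 < s0) (h01 : s0 < s1) (h1 : s1 < 1)
    (hx : 0 ≤ x) (hxy : x ≤ ρ * y) : WW ρ s1 x y ≤ WW ρ s0 x y := by
  have hρ : 0 < ρ := by linarith
  have hxy' : x / ρ ≤ y := by rw [div_le_iff₀ hρ]; linarith
  have hxρ : 0 ≤ x / ρ := by positivity
  have hy : 0 ≤ y := hxρ.trans hxy'
  unfold WW
  have e1 : (x / ρ) ^ s1 = (x / ρ) ^ s0 * (x / ρ) ^ (s1 - s0) := by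
    rw [← Real.rpow_add_of_nonneg hxρ h0.le (by linarith)]; congr 1; ring
  have e2 : y ^ (1 - s0) = y ^ (s1 - s0) * y ^ (1 - s1) := by
    rw [← Real.rpow_add_of_nonneg hy (by linarith) (by linarith)]; congr 1; ring
  rw [e1, e2, ← mul_assoc]
  gcongr

/-- The potential. -/
def pot (ρ s0 s1 s2 β τ A Q x y : ℝ) : ℝ :=
  Real.exp (β * Q) * (WW ρ s1 x y - WW ρ s0 x y) - A * Real.exp ((β - τ) * Q) * WW ρ s2 x y

lemma pot_nonpos {ρ s0 s1 s2 β τ A Q x y : ℝ} (h : 1 < ρ) (h0 : 0 < s0) (h01 : s0 < s1)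
    (h1 : s1 < 1) (hA : 0 ≤ A) (hx : 0 ≤ x) (hy : 0 ≤ y) (hxy : x ≤ ρ * y) :
    pot ρ s0 s1 s2 β τ A Q x y ≤ 0 := by
  have h1 := WW_le h h0 h01 h1 hx hxy
  have h2 := WW_nonneg (s := s2) h hx hy
  have h3 : 0 ≤ A * Real.exp ((β - τ) * Q) * WW ρ s2 x y := by positivity
  have h4 := Real.exp_pos (β * Q)
  unfold pot
  nlinarith

lemma pot_step {ρ s0 s1 s2 β τ A Q x y q : ℝ} (h : 1 < ρ) (hA : 0 ≤ A) (hx : 0 ≤ x) (hy : 0 ≤ y)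
    (hq : 0 ≤ q) (hq1 : ρ * q ≤ 1)
    (m0 : mulM ρ q s0 ≤ Real.exp (-β * q)) (m1 : Real.exp (-β * q) ≤ mulM ρ q s1)
    (m2 : mulM ρ q s2 ≤ Real.exp ((τ - β) * q)) :
    pot ρ s0 s1 s2 β τ A Q x y ≤ pot ρ s0 s1 s2 β τ A (Q + q) (x * (1 - q)) (y * (1 - ρ * q))
      + pot ρ s0 s1 s2 β τ A (Q + q) (x * q) (y * (ρ * q)) := by
  have w0 := WW_nonneg (s := s0) h hx hy
  have w1 := WW_nonneg (s := s1) h hx hy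
  have w2 := WW_nonneg (s := s2) h hx hy
  have r0 := WW_step (s := s0) h hx hy hq hq1
  have r1 := WW_step (s := s1) h hx hy hq hq1
  have r2 := WW_step (s := s2) h hx hy hq hq1
  have e1 : Real.exp (β * (Q + q)) * Real.exp (-β * q) = Real.exp (β * Q) := by
    rw [← Real.exp_add]; ring_nf
  have e2 : Real.exp ((β - τ) * (Q + q)) * Real.exp ((τ - β) * q) = Real.exp ((β - τ) * Q) := by
    rw [← Real.exp_add]; ring_nf
  have : pot ρ s0 s1 s2 β τ A (Q + q) (x * (1 - q)) (y * (1 - ρ * q))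
      + pot ρ s0 s1 s2 β τ A (Q + q) (x * q) (y * (ρ * q))
      = Real.exp (β * (Q + q)) * (mulM ρ q s1 * WW ρ s1 x y - mulM ρ q s0 * WW ρ s0 x y)
        - A * Real.exp ((β - τ) * (Q + q)) * (mulM ρ q s2 * WW ρ s2 x y) := by
    rw [← r0, ← r1, ← r2]; unfold pot; ring
  rw [this]
  unfold pot
  rw [← e1, ← e2]
  have a1 : Real.exp (-β * q) * (WW ρ s1 x y - WW ρ s0 x y) ≤
      mulM ρ q s1 * WW ρ s1 x y - mulM ρ q s0 * WW ρ s0 x y := by nlinarith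
  have a2 : mulM ρ q s2 * WW ρ s2 x y ≤ Real.exp ((τ - β) * q) * WW ρ s2 x y := by gcongr
  have a3 := mul_le_mul_of_nonneg_left a1 (Real.exp_pos (β * (Q + q))).le
  have a4 := mul_le_mul_of_nonneg_left a2
    (mul_nonneg hA (Real.exp_pos ((β - τ) * (Q + q))).le)
  linarith

lemma WW_eq {ρ s x y : ℝ} (h : 1 < ρ) (hx : 0 ≤ x) (hy : 0 < y) :
    WW ρ s x y = (x / ρ / y) ^ s * y := by
  have hρ : 0 < ρ := by linarith
  unfold WW
  rw [Real.div_rpow (by positivity) hy.le, Real.rpow_sub hy, Real.rpow_one]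
  have : 0 < y ^ s := by positivity
  field_simp

lemma pot_term {ρ s0 s1 s2 β τ A Q x y : ℝ} (h : 1 < ρ) (h0 : 0 < s0) (h01 : s0 < s1)
    (h12 : s1 < s2) (h2 : s2 < 1) (hA : 0 < A) (hx : 0 ≤ x) (hy : 0 ≤ y) :
    pot ρ s0 s1 s2 β τ A Q x y ≤
      A⁻¹ ^ (s1 / (s2 - s1)) * Real.exp ((β + τ * (s1 / (s2 - s1))) * Q) * y := by
  have hρ : 0 < ρ := by linarith
  rcases hy.eq_or_lt with rfl | hy'
  · unfold pot WW
    rw [Real.zero_rpow (by linarith), Real.zero_rpow (by linarith), Real.zero_rpow (by linarith)]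
    simp
  have w0 := WW_nonneg (s := s0) h hx hy
  have hE : 0 < Real.exp (β * Q) := Real.exp_pos _
  set r := x / ρ / y with hr
  have hr0 : 0 ≤ r := by positivity
  have key : r ^ s1 - A * Real.exp (-τ * Q) * r ^ s2
      ≤ A⁻¹ ^ (s1 / (s2 - s1)) * Real.exp (τ * Q * (s1 / (s2 - s1))) := by
    have e : r ^ s2 = r ^ s1 * r ^ (s2 - s1) := by
      rw [← Real.rpow_add_of_nonneg hr0 (by linarith) (by linarith)]; congr 1; ring
    have hd : 0 < s2 - s1 := by linarith
    have hs1 : 0 < s1 := by linarith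
    have n1 : 0 ≤ r ^ s1 := by positivity
    by_cases hc : r ^ (s2 - s1) ≤ A⁻¹ * Real.exp (τ * Q)
    · have e2 : r ^ s1 = (r ^ (s2 - s1)) ^ (s1 / (s2 - s1)) := by
        rw [← Real.rpow_mul hr0]; congr 1; field_simp
      have e3 := Real.rpow_le_rpow (by positivity) hc (by positivity : 0 ≤ s1 / (s2 - s1))
      rw [← e2, Real.mul_rpow (by positivity) (by positivity), ← Real.exp_mul] at e3
      have : 0 ≤ A * Real.exp (-τ * Q) * r ^ s2 := by positivity
      linarith
    · push Not at hc
      have : 1 ≤ A * Real.exp (-τ * Q) * r ^ (s2 - s1) := by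
        calc (1:ℝ) = A * Real.exp (-τ * Q) * (A⁻¹ * Real.exp (τ * Q)) := by
              have : Real.exp (-τ * Q) * Real.exp (τ * Q) = 1 := by
                rw [← Real.exp_add]; simp
              rw [mul_mul_mul_comm, this, mul_inv_cancel₀ hA.ne', one_mul]
          _ ≤ _ := by gcongr
      have h9 : 0 ≤ A⁻¹ ^ (s1 / (s2 - s1)) * Real.exp (τ * Q * (s1 / (s2 - s1))) := by positivity
      rw [e]
      nlinarith
  have e5 : Real.exp ((β - τ) * Q) = Real.exp (β * Q) * Real.exp (-τ * Q) := by
    rw [← Real.exp_add]; ring_nf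
  have e6 : Real.exp ((β + τ * (s1 / (s2 - s1))) * Q)
      = Real.exp (β * Q) * Real.exp (τ * Q * (s1 / (s2 - s1))) := by
    rw [← Real.exp_add]; ring_nf
  have k2 := mul_le_mul_of_nonneg_left key (mul_pos hE hy').le
  unfold pot
  rw [e5, e6, WW_eq h hx hy' (s := s1), WW_eq h hx hy' (s := s2), ← hr]
  have : 0 ≤ Real.exp (β * Q) * WW ρ s0 x y := by positivity
  linarith

section Prob

variable {a b : ℝ} {p : ℕ → ℝ} {Ω : Type*} [MeasurableSpace Ω] {μ : Measure Ω} {θ : Ω → ℕ}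
  {X I Z : ℕ → Ω → ℕ}

/-- Joint probability of state `i` and public history `z` up to `n`. -/
def LL (μ : Measure Ω) (θ : Ω → ℕ) (Z : ℕ → Ω → ℕ) (i n : ℕ) (z : ℕ → ℕ) : ℝ :=
  (μ {ω | θ ω = i ∧ ∀ s ∈ Finset.Icc 1 n, Z s ω = z s}).toReal

lemma LL_nonneg (i n : ℕ) (z : ℕ → ℕ) : 0 ≤ LL μ θ Z i n z := ENNReal.toReal_nonneg

lemma Dlike_congr (t i : ℕ) (ω ω' : Ω) (h : ∀ s ∈ Finset.Icc 1 (t - 1), Z s ω = Z s ω')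
    (hX : X t ω = X t ω') : Dlike μ θ X Z t i ω = Dlike μ θ X Z t i ω' := by
  unfold Dlike
  have : {ω'' | θ ω'' = i ∧ (∀ s ∈ Finset.Icc 1 (t - 1), Z s ω'' = Z s ω) ∧ X t ω'' = X t ω}
    = {ω'' | θ ω'' = i ∧ (∀ s ∈ Finset.Icc 1 (t - 1), Z s ω'' = Z s ω') ∧ X t ω'' = X t ω'} := by
    ext ω''
    simp only [Set.mem_ofPred_eq, hX]
    refine and_congr_right fun _ => and_congr_left fun _ => ?_
    exact forall₂_congr fun s hs => by rw [h s hs]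
  rw [this]

lemma Z_det (hC : IsCascade a b p μ θ X I Z) (ω ω' : Ω) (n : ℕ)
    (h : ∀ s ∈ Finset.Icc 1 n, X s ω = X s ω' ∧ I s ω = I s ω') :
    ∀ s ∈ Finset.Icc 1 n, Z s ω = Z s ω' := by
  intro s
  induction s using Nat.strong_induction_on with
  | _ s ih =>
    intro hs
    have hs' := Finset.mem_Icc.1 hs
    have hD : ∀ i, Dlike μ θ X Z s i ω = Dlike μ θ X Z s i ω' := by
      intro i
      refine Dlike_congr s i ω ω' (fun r hr => ?_) (h s hs).1
      have hr' := Finset.mem_Icc.1 hr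
      exact ih r (by omega) (Finset.mem_Icc.2 ⟨hr'.1, by omega⟩)
    rw [hC.dynamics s hs'.1, hC.dynamics s hs'.1, (h s hs).1, (h s hs).2]
    unfold mapEst
    rw [hD 1, hD 2, (h s hs).1]

/-- coding of the finite configuration -/
def cfg (X I : ℕ → Ω → ℕ) (n : ℕ) (ω : Ω) : Finset.Icc 1 n → Bool × Bool :=
  fun s => (decide (X s ω = 1), decide (I s ω = 1))

def exX {n : ℕ} (v : Finset.Icc 1 n → Bool × Bool) (t : ℕ) : ℕ :=
  if h : t ∈ Finset.Icc 1 n then (if (v ⟨t, h⟩).1 then 1 else 2) else 1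

def exI {n : ℕ} (v : Finset.Icc 1 n → Bool × Bool) (t : ℕ) : ℕ :=
  if h : t ∈ Finset.Icc 1 n then (if (v ⟨t, h⟩).2 then 1 else 0) else 1

lemma cfg_preimage (hC : IsCascade a b p μ θ X I Z) (n : ℕ) (v : Finset.Icc 1 n → Bool × Bool) :
    cfg X I n ⁻¹' {v} = {ω | ∀ t ∈ Finset.Icc 1 n, X t ω = exX v t ∧ I t ω = exI v t} := by
  ext ω
  simp only [Set.mem_preimage, Set.mem_singleton_iff, Set.mem_ofPred_eq]
  constructor
  · rintro rfl t ht
    rcases hC.X_range t ω with h1 | h1 <;> rcases hC.I_range t ω with h2 | h2 <;>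
      simp [exX, exI, cfg, ht, h1, h2]
  · intro h
    funext ⟨t, ht⟩
    obtain ⟨h1, h2⟩ := h t ht
    simp only [cfg, h1, h2, exX, exI, ht, dite_true]
    rcases hv : v ⟨t, ht⟩ with ⟨u, w⟩
    cases u <;> cases w <;> simp

lemma meas_cfg (hC : IsCascade a b p μ θ X I Z) (n : ℕ) (v : Finset.Icc 1 n → Bool × Bool) :
    MeasurableSet (cfg X I n ⁻¹' {v}) := by
  rw [cfg_preimage hC]
  have : {ω | ∀ t ∈ Finset.Icc 1 n, X t ω = exX v t ∧ I t ω = exI v t}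
      = ⋂ t ∈ Finset.Icc 1 n, (X t ⁻¹' {exX v t} ∩ I t ⁻¹' {exI v t}) := by
    ext ω; simp
  rw [this]
  exact Finset.measurableSet_biInter _ fun t _ =>
    ((hC.X_meas t) (measurableSet_singleton _)).inter ((hC.I_meas t) (measurableSet_singleton _))

lemma sum_cfg (hC : IsCascade a b p μ θ X I Z) (n : ℕ) (T : Set Ω)
    (s : Finset (Finset.Icc 1 n → Bool × Bool)) :
    (μ (T ∩ cfg X I n ⁻¹' ↑s)).toReal = ∑ v ∈ s, (μ (T ∩ cfg X I n ⁻¹' {v})).toReal := by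
  have := hC.prob
  have h := sum_measure_preimage_singleton (μ := μ.restrict T) s (f := cfg X I n)
    (fun y _ => meas_cfg hC n y)
  have hm : MeasurableSet (cfg X I n ⁻¹' (↑s : Set (Finset.Icc 1 n → Bool × Bool))) := by
    have : cfg X I n ⁻¹' (↑s : Set (Finset.Icc 1 n → Bool × Bool))
        = ⋃ v ∈ s, cfg X I n ⁻¹' {v} := by ext ω; simp
    rw [this]
    exact Finset.measurableSet_biUnion _ fun v _ => meas_cfg hC n v
  rw [Measure.restrict_apply hm] at h
  rw [Set.inter_comm, ← h, ENNReal.toReal_sum (fun v _ => measure_ne_top _ _)]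
  refine Finset.sum_congr rfl fun v _ => ?_
  rw [Measure.restrict_apply (meas_cfg hC n v), Set.inter_comm]

lemma hist_eq (hC : IsCascade a b p μ θ X I Z) (n : ℕ) (z : ℕ → ℕ) :
    ∃ s : Finset (Finset.Icc 1 n → Bool × Bool),
      {ω | ∀ s ∈ Finset.Icc 1 n, Z s ω = z s} = cfg X I n ⁻¹' ↑s := by
  classical
  refine ⟨Finset.univ.filter (fun v => v ∈ cfg X I n '' {ω | ∀ s ∈ Finset.Icc 1 n, Z s ω = z s}), ?_⟩
  ext ω
  simp only [Set.mem_ofPred_eq, Set.mem_image, Finset.coe_filter, Finset.mem_univ, true_and,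
    Set.mem_preimage]
  constructor
  · intro h; exact ⟨ω, h, rfl⟩
  · rintro ⟨ω', h, h'⟩ s hs
    have hw : ω ∈ cfg X I n ⁻¹' {cfg X I n ω} := rfl
    have hw' : ω' ∈ cfg X I n ⁻¹' {cfg X I n ω} := h'
    rw [cfg_preimage hC] at hw hw'
    have := Z_det hC ω ω' n (fun t ht => by
      rw [(hw t ht).1, (hw t ht).2, (hw' t ht).1, (hw' t ht).2]; exact ⟨rfl, rfl⟩) s hs
    rw [this]; exact h s hs

lemma indep (hC : IsCascade a b p μ θ X I Z) {i : ℕ} (hi : i = 1 ∨ i = 2) (n : ℕ) (z : ℕ → ℕ)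
    {x c : ℕ} (hx : x = 1 ∨ x = 2) (hc : c = 0 ∨ c = 1) :
    (μ {ω | (θ ω = i ∧ X (n+1) ω = x ∧ I (n+1) ω = c) ∧ ∀ s ∈ Finset.Icc 1 n, Z s ω = z s}).toReal
      = LL μ θ Z i n z * (signalProb a b i x * (if c = 1 then p (n+1) else 1 - p (n+1))) := by
  obtain ⟨S, hS⟩ := hist_eq hC n z
  unfold LL
  simp only [Set.ofPred_and (p := fun ω => θ ω = i ∧ X (n+1) ω = x ∧ I (n+1) ω = c),
    Set.ofPred_and (p := fun ω => θ ω = i) (q := fun ω => ∀ s ∈ Finset.Icc 1 n, Z s ω = z s), hS]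
  rw [sum_cfg hC, sum_cfg hC, Finset.sum_mul]
  refine Finset.sum_congr rfl fun v _ => ?_
  have hnot : n + 1 ∉ Finset.Icc 1 n := by simp
  have hX1 : ∀ t, exX v t = 1 ∨ exX v t = 2 := by
    intro t; unfold exX; split_ifs <;> simp
  have hI1 : ∀ t, exI v t = 0 ∨ exI v t = 1 := by
    intro t; unfold exI; split_ifs <;> simp
  have j1 := hC.joint i hi (Finset.Icc 1 n) (fun t ht => (Finset.mem_Icc.1 ht).1) (exX v) (exI v)
    hX1 hI1
  have j2 := hC.joint i hi (insert (n+1) (Finset.Icc 1 n)) (fun t ht => by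
      rcases Finset.mem_insert.1 ht with h | h
      · omega
      · exact (Finset.mem_Icc.1 h).1)
    (Function.update (exX v) (n+1) x) (Function.update (exI v) (n+1) c)
    (fun t => by
      by_cases h : t = n + 1
      · subst h; simpa using hx
      · rw [Function.update_of_ne h]; exact hX1 t)
    (fun t => by
      by_cases h : t = n + 1
      · subst h; simpa using hc
      · rw [Function.update_of_ne h]; exact hI1 t)
  rw [Finset.prod_insert hnot, Function.update_self, Function.update_self] at j2
  have hne : ∀ t ∈ Finset.Icc 1 n, t ≠ n + 1 := fun t ht h => hnot (h ▸ ht)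
  rw [Finset.prod_congr rfl (g := fun t => signalProb a b i (exX v t) *
    (if exI v t = 1 then p t else 1 - p t)) (fun t ht => by
      rw [Function.update_of_ne (hne t ht), Function.update_of_ne (hne t ht)])] at j2
  rw [cfg_preimage hC]
  have s1 : {ω | θ ω = i} ∩ {ω | ∀ t ∈ Finset.Icc 1 n, X t ω = exX v t ∧ I t ω = exI v t}
    = {ω | θ ω = i ∧ ∀ t ∈ Finset.Icc 1 n, X t ω = exX v t ∧ I t ω = exI v t} := rfl
  have s2 : {ω | θ ω = i ∧ X (n+1) ω = x ∧ I (n+1) ω = c} ∩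
      {ω | ∀ t ∈ Finset.Icc 1 n, X t ω = exX v t ∧ I t ω = exI v t}
    = {ω | θ ω = i ∧ ∀ t ∈ insert (n+1) (Finset.Icc 1 n),
      X t ω = Function.update (exX v) (n+1) x t ∧ I t ω = Function.update (exI v) (n+1) c t} := by
    ext ω
    simp only [Set.mem_inter_iff, Set.mem_ofPred_eq, Finset.forall_mem_insert, Function.update_self]
    have : (∀ t ∈ Finset.Icc 1 n, X t ω = Function.update (exX v) (n+1) x t ∧
        I t ω = Function.update (exI v) (n+1) c t) ↔
        ∀ t ∈ Finset.Icc 1 n, X t ω = exX v t ∧ I t ω = exI v t :=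
      forall₂_congr fun t ht => by
        rw [Function.update_of_ne (hne t ht), Function.update_of_ne (hne t ht)]
    rw [this]; tauto
  rw [s1, s2, j1, j2]; ring

lemma theta_half (hC : IsCascade a b p μ θ X I Z) {i : ℕ} (hi : i = 1 ∨ i = 2) :
    (μ {ω | θ ω = i}).toReal = 1 / 2 := by
  have := hC.joint i hi ∅ (by simp) (fun _ => 1) (fun _ => 1) (by simp) (by simp)
  simpa using this

lemma meas_hist (hC : IsCascade a b p μ θ X I Z) (n : ℕ) (z : ℕ → ℕ) :
    MeasurableSet {ω | ∀ s ∈ Finset.Icc 1 n, Z s ω = z s} := by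
  have : {ω | ∀ s ∈ Finset.Icc 1 n, Z s ω = z s} = ⋂ s ∈ Finset.Icc 1 n, Z s ⁻¹' {z s} := by
    ext ω; simp
  rw [this]
  exact Finset.measurableSet_biInter _ fun t _ => (hC.Z_meas t) (measurableSet_singleton _)

lemma split_meas (hC : IsCascade a b p μ θ X I Z) (S : Set Ω) (f : Ω → ℕ) (hf : Measurable f)
    (u v : ℕ) (huv : u ≠ v) (h : ∀ ω, f ω = u ∨ f ω = v) :
    (μ S).toReal = (μ {ω | ω ∈ S ∧ f ω = u}).toReal + (μ {ω | ω ∈ S ∧ f ω = v}).toReal := by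
  have := hC.prob
  rw [← measure_inter_add_sdiff S (hf (measurableSet_singleton u)),
    ENNReal.toReal_add (measure_ne_top _ _) (measure_ne_top _ _)]
  congr 3
  ext ω
  simp only [Set.mem_sdiff, Set.mem_preimage, Set.mem_singleton_iff, Set.mem_ofPred_eq]
  refine and_congr_right fun _ => ?_
  rcases h ω with h | h <;> rw [h]
  · simp [huv]
  · simp [huv.symm]

lemma indepX (hC : IsCascade a b p μ θ X I Z) {i : ℕ} (hi : i = 1 ∨ i = 2) (n : ℕ) (z : ℕ → ℕ)
    {x : ℕ} (hx : x = 1 ∨ x = 2) :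
    (μ {ω | θ ω = i ∧ (∀ s ∈ Finset.Icc 1 n, Z s ω = z s) ∧ X (n+1) ω = x}).toReal
      = LL μ θ Z i n z * signalProb a b i x := by
  rw [split_meas hC _ (I (n+1)) (hC.I_meas _) 0 1 (by norm_num) (hC.I_range _)]
  have h0 := indep hC hi n z hx (c := 0) (by simp)
  have h1 := indep hC hi n z hx (c := 1) (by simp)
  have e : ∀ c, {ω | ω ∈ {ω | θ ω = i ∧ (∀ s ∈ Finset.Icc 1 n, Z s ω = z s) ∧ X (n+1) ω = x} ∧
      I (n+1) ω = c} = {ω | (θ ω = i ∧ X (n+1) ω = x ∧ I (n+1) ω = c) ∧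
        ∀ s ∈ Finset.Icc 1 n, Z s ω = z s} := by
    intro c; ext ω; simp only [Set.mem_ofPred_eq]; tauto
  rw [e, e, h0, h1]; simp; ring

lemma Dlike_eq (hC : IsCascade a b p μ θ X I Z) {i : ℕ} (hi : i = 1 ∨ i = 2) (n : ℕ) (z : ℕ → ℕ)
    (ω : Ω) (hω : ∀ s ∈ Finset.Icc 1 n, Z s ω = z s) :
    Dlike μ θ X Z (n+1) i ω = 2 * (LL μ θ Z i n z * signalProb a b i (X (n+1) ω)) := by
  unfold Dlike
  rw [theta_half hC hi, ← indepX hC hi n z (hC.X_range _ _), Nat.add_sub_cancel]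
  have : {ω' | θ ω' = i ∧ (∀ s ∈ Finset.Icc 1 n, Z s ω' = Z s ω) ∧ X (n+1) ω' = X (n+1) ω}
    = {ω' | θ ω' = i ∧ (∀ s ∈ Finset.Icc 1 n, Z s ω' = z s) ∧ X (n+1) ω' = X (n+1) ω} := by
    ext ω'
    simp only [Set.mem_ofPred_eq]
    refine and_congr_right fun _ => and_congr_left fun _ => ?_
    exact forall₂_congr fun s hs => by rw [hω s hs]
  rw [this]; ring

lemma map_cascade (hb : 0 < b) (hab : b < a) (hC : IsCascade a b p μ θ X I Z) (n : ℕ) (z : ℕ → ℕ)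
    (hL : a * LL μ θ Z 2 n z < b * LL μ θ Z 1 n z)
    (ω : Ω) (hω : ∀ s ∈ Finset.Icc 1 n, Z s ω = z s) : mapEst μ θ X Z (n+1) ω = 1 := by
  have h1 := LL_nonneg (μ := μ) (θ := θ) (Z := Z) 1 n z
  have h2 := LL_nonneg (μ := μ) (θ := θ) (Z := Z) 2 n z
  unfold mapEst
  rw [Dlike_eq hC (by simp) n z ω hω, Dlike_eq hC (by simp) n z ω hω, if_pos]
  have hs : 0 < a + b := by linarith
  rcases hC.X_range (n+1) ω with h | h <;> rw [h] <;> simp only [signalProb] <;> norm_num <;>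
    rw [mul_div_assoc', mul_div_assoc'] <;> gcongr ?_ / _ <;> nlinarith

lemma map_learn (hb : 0 < b) (hab : b < a) (hC : IsCascade a b p μ θ X I Z) (n : ℕ) (z : ℕ → ℕ)
    (h0 : 0 < LL μ θ Z 2 n z) (h1 : LL μ θ Z 2 n z ≤ LL μ θ Z 1 n z)
    (hL : b * LL μ θ Z 1 n z ≤ a * LL μ θ Z 2 n z)
    (ω : Ω) (hω : ∀ s ∈ Finset.Icc 1 n, Z s ω = z s) :
    mapEst μ θ X Z (n+1) ω = X (n+1) ω := by
  unfold mapEst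
  rw [Dlike_eq hC (by simp) n z ω hω, Dlike_eq hC (by simp) n z ω hω]
  have hs : 0 < a + b := by linarith
  rcases hC.X_range (n+1) ω with h | h
  · rw [h, if_pos]
    simp only [signalProb]; norm_num
    rw [mul_div_assoc', mul_div_assoc']; gcongr ?_ / _; nlinarith
  · rw [h, if_neg]
    · simp
    · simp only [signalProb]; norm_num
      rw [mul_div_assoc', mul_div_assoc']; gcongr ?_ / _; nlinarith

lemma Icc_step (n : ℕ) (z : ℕ → ℕ) (k : ℕ) (ω : Ω) :
    (∀ s ∈ Finset.Icc 1 (n+1), Z s ω = Function.update z (n+1) k s) ↔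
      (∀ s ∈ Finset.Icc 1 n, Z s ω = z s) ∧ Z (n+1) ω = k := by
  rw [← Finset.insert_Icc_right_eq_Icc_add_one (by omega), Finset.forall_mem_insert,
    Function.update_self, and_comm]
  refine and_congr_left fun _ => forall₂_congr fun s hs => ?_
  rw [Function.update_of_ne]
  rintro rfl
  simp at hs

lemma Z_range (hC : IsCascade a b p μ θ X I Z) (n : ℕ) (ω : Ω) : Z n ω = 1 ∨ Z n ω = 2 := by
  rcases Nat.eq_zero_or_pos n with rfl | hn
  · exact Or.inl (hC.Z_zero ω)
  · rw [hC.dynamics n hn, mapEst]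
    have := hC.X_range n ω
    split_ifs <;> simp [this]

lemma LL_split (hC : IsCascade a b p μ θ X I Z) (i n : ℕ) (z : ℕ → ℕ) :
    LL μ θ Z i n z = LL μ θ Z i (n+1) (Function.update z (n+1) 1)
      + LL μ θ Z i (n+1) (Function.update z (n+1) 2) := by
  unfold LL
  rw [split_meas hC _ (Z (n+1)) (hC.Z_meas _) 1 2 (by norm_num) (Z_range hC _)]
  simp only [Icc_step, Set.mem_ofPred_eq, and_assoc]

lemma LL_two (hb : 0 < b) (hab : b < a) (hC : IsCascade a b p μ θ X I Z) {i : ℕ}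
    (hi : i = 1 ∨ i = 2) (n : ℕ) (z : ℕ → ℕ)
    (hL : a * LL μ θ Z 2 n z < b * LL μ θ Z 1 n z) :
    LL μ θ Z i (n+1) (Function.update z (n+1) 2)
      = LL μ θ Z i n z * (signalProb a b i 2 * p (n+1)) := by
  have := indep hC hi n z (x := 2) (c := 1) (by simp) (by simp)
  rw [if_pos rfl] at this
  rw [← this, LL]
  congr 2
  ext ω
  simp only [Icc_step, Set.mem_ofPred_eq]
  constructor
  · rintro ⟨h1, h2, h3⟩
    rw [hC.dynamics (n+1) (by omega), map_cascade hb hab hC n z hL ω h2] at h3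
    by_cases hI : I (n+1) ω = 1
    · rw [if_pos hI] at h3; exact ⟨⟨h1, h3, hI⟩, h2⟩
    · rw [if_neg hI] at h3; omega
  · rintro ⟨⟨h1, h2, h3⟩, h4⟩
    exact ⟨h1, h4, by rw [hC.dynamics (n+1) (by omega), if_pos h3, h2]⟩

lemma LL_learn (hb : 0 < b) (hab : b < a) (hC : IsCascade a b p μ θ X I Z) {i : ℕ}
    (hi : i = 1 ∨ i = 2) (n : ℕ) (z : ℕ → ℕ)
    (h0 : 0 < LL μ θ Z 2 n z) (h1 : LL μ θ Z 2 n z ≤ LL μ θ Z 1 n z)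
    (hL : b * LL μ θ Z 1 n z ≤ a * LL μ θ Z 2 n z) :
    LL μ θ Z i (n+1) (Function.update z (n+1) 1)
      = LL μ θ Z i n z * signalProb a b i 1 := by
  rw [← indepX hC hi n z (x := 1) (by simp), LL]
  congr 2
  ext ω
  simp only [Icc_step, Set.mem_ofPred_eq]
  refine and_congr_right fun _ => and_congr_right fun h2 => ?_
  rw [hC.dynamics (n+1) (by omega), map_learn hb hab hC n z h0 h1 hL ω h2, ite_self]

lemma start (hb : 0 < b) (hab : b < a) (hC : IsCascade a b p μ θ X I Z) (m : ℕ) :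
    0 < LL μ θ Z 2 (m+2) (fun _ => 1) ∧
      a * LL μ θ Z 2 (m+2) (fun _ => 1) < b * LL μ θ Z 1 (m+2) (fun _ => 1) := by
  have hs : 0 < a + b := by linarith
  have ha : 0 < a := by linarith
  have hu : ∀ n : ℕ, Function.update (fun _ : ℕ => 1) n 1 = fun _ => 1 := by
    intro n; simp
  induction m with
  | zero =>
    have e0 : ∀ i, (i = 1 ∨ i = 2) → LL μ θ Z i 0 (fun _ => 1) = 1 / 2 := by
      intro i hi; rw [← theta_half hC hi, LL]; simp
    have l1 : ∀ i, (i = 1 ∨ i = 2) → LL μ θ Z i 1 (fun _ => 1) = 1 / 2 * signalProb a b i 1 := by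
      intro i hi
      have := LL_learn hb hab hC hi 0 (fun _ => 1) (by rw [e0 2 (by simp)]; norm_num)
        (by rw [e0 2 (by simp), e0 1 (by simp)])
        (by rw [e0 2 (by simp), e0 1 (by simp)]; linarith)
      rwa [hu, e0 i hi] at this
    have l11 := l1 1 (by simp)
    have l12 := l1 2 (by simp)
    simp only [signalProb] at l11 l12
    norm_num at l11 l12
    have l2 : ∀ i, (i = 1 ∨ i = 2) → LL μ θ Z i 2 (fun _ => 1)
        = LL μ θ Z i 1 (fun _ => 1) * signalProb a b i 1 := by
      intro i hi
      have := LL_learn hb hab hC hi 1 (fun _ => 1) (by rw [l12]; positivity)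
        (by rw [l12, l11]; gcongr)
        (by rw [l12, l11]; apply le_of_eq; ring)
      rwa [hu] at this
    have l21 := l2 1 (by simp)
    have l22 := l2 2 (by simp)
    simp only [signalProb] at l21 l22
    norm_num at l21 l22
    rw [zero_add, l21, l22, l11, l12]
    refine ⟨by positivity, ?_⟩
    have : b * (1 / 2 * (a / (a + b)) * (a / (a + b))) - a * (1 / 2 * (b / (a + b)) * (b / (a + b)))
      = a * b * (a - b) / (2 * (a + b) ^ 2) := by field_simp
    have h2 : 0 < a * b * (a - b) / (2 * (a + b) ^ 2) := by
      have : 0 < a - b := by linarith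
      positivity
    linarith
  | succ m ih =>
    obtain ⟨h1, h2⟩ := ih
    have t1 := LL_two hb hab hC (i := 1) (by simp) (m+2) _ h2
    have t2 := LL_two hb hab hC (i := 2) (by simp) (m+2) _ h2
    have s1 := LL_split hC 1 (m+2) (fun _ => 1)
    have s2 := LL_split hC 2 (m+2) (fun _ => 1)
    rw [hu, t1] at s1
    rw [hu, t2] at s2
    simp only [signalProb] at s1 s2
    norm_num at s1 s2
    have hp := hC.p_mem (m+2+1) (by omega)
    obtain ⟨hp0, hp1⟩ := hp
    have q1 : a / (a + b) * p (m+2+1) < 1 := by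
      rw [div_mul_eq_mul_div, div_lt_one hs]; nlinarith
    have q2 : b / (a + b) * p (m+2+1) ≤ a / (a + b) * p (m+2+1) := by gcongr
    set L1 := LL μ θ Z 1 (m+2) (fun _ => 1)
    set L2 := LL μ θ Z 2 (m+2) (fun _ => 1)
    have eq1 : LL μ θ Z 1 (m+2+1) (fun _ => 1) = L1 * (1 - b / (a + b) * p (m+2+1)) := by linarith
    have eq2 : LL μ θ Z 2 (m+2+1) (fun _ => 1) = L2 * (1 - a / (a + b) * p (m+2+1)) := by linarith
    rw [show m + 1 + 2 = m + 2 + 1 by ring, eq1, eq2]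
    refine ⟨mul_pos h1 (by linarith), ?_⟩
    have h4 : 0 < b * L1 := by nlinarith
    nlinarith

end Prob

/-- Cumulative contrarian rate. -/
def QQ (a b : ℝ) (p : ℕ → ℝ) (n : ℕ) : ℝ := ∑ k ∈ Finset.range n, b / (a + b) * p (k + 1)

lemma main_ind {a b : ℝ} {p : ℕ → ℝ} {Ω : Type*} [MeasurableSpace Ω] {μ : Measure Ω} {θ : Ω → ℕ}
    {X I Z : ℕ → Ω → ℕ} (hb : 0 < b) (hab : b < a) (hC : IsCascade a b p μ θ X I Z)
    {s0 s1 s2 β τ A q0 : ℝ} (h0 : 0 < s0) (h01 : s0 < s1) (h12 : s1 < s2) (h2 : s2 < 1)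
    (hA : 0 < A)
    (hm : ∀ q, 0 ≤ q → q ≤ q0 → a / b * q ≤ 1 ∧ mulM (a / b) q s0 ≤ Real.exp (-β * q) ∧
        Real.exp (-β * q) ≤ mulM (a / b) q s1 ∧ mulM (a / b) q s2 ≤ Real.exp ((τ - β) * q))
    (t0 t : ℕ) (hq : ∀ n, t0 ≤ n → b / (a + b) * p (n + 1) ≤ q0) (k : ℕ) :
    ∀ (z : ℕ → ℕ) (n : ℕ), n + k = t → t0 ≤ n →
      pot (a / b) s0 s1 s2 β τ A (QQ a b p n) (LL μ θ Z 1 n z) (LL μ θ Z 2 n z) ≤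
        A⁻¹ ^ (s1 / (s2 - s1)) * Real.exp ((β + τ * (s1 / (s2 - s1))) * QQ a b p t) *
        (μ {ω | mapEst μ θ X Z (t+1) ω ≠ θ ω ∧ ∀ s ∈ Finset.Icc 1 n, Z s ω = z s}).toReal := by
  have := hC.prob
  have hρ : 1 < a / b := by rwa [one_lt_div hb]
  have hs : 0 < a + b := by linarith
  set K := A⁻¹ ^ (s1 / (s2 - s1)) * Real.exp ((β + τ * (s1 / (s2 - s1))) * QQ a b p t) with hK
  have hK0 : 0 ≤ K := by positivity
  have dead : ∀ (z : ℕ → ℕ) (n : ℕ), ¬ (a * LL μ θ Z 2 n z < b * LL μ θ Z 1 n z) →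
      pot (a / b) s0 s1 s2 β τ A (QQ a b p n) (LL μ θ Z 1 n z) (LL μ θ Z 2 n z) ≤
        K * (μ {ω | mapEst μ θ X Z (t+1) ω ≠ θ ω ∧ ∀ s ∈ Finset.Icc 1 n, Z s ω = z s}).toReal := by
    intro z n hd
    have : pot (a / b) s0 s1 s2 β τ A (QQ a b p n) (LL μ θ Z 1 n z) (LL μ θ Z 2 n z) ≤ 0 := by
      refine pot_nonpos hρ h0 h01 (by linarith) hA.le (LL_nonneg _ _ _) (LL_nonneg _ _ _) ?_
      rw [div_mul_eq_mul_div, le_div_iff₀ hb]; linarith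
    exact this.trans (mul_nonneg hK0 ENNReal.toReal_nonneg)
  induction k with
  | zero =>
    intro z n hn ht0
    by_cases hd : a * LL μ θ Z 2 n z < b * LL μ θ Z 1 n z
    swap
    · exact dead z n hd
    have hn' : n = t := by omega
    subst hn'
    refine (pot_term hρ h0 h01 h12 h2 hA (LL_nonneg _ _ _) (LL_nonneg _ _ _)).trans ?_
    rw [← hK]
    refine mul_le_mul_of_nonneg_left ?_ hK0
    refine ENNReal.toReal_mono (measure_ne_top _ _) (measure_mono ?_)
    rintro ω ⟨hω1, hω2⟩
    refine ⟨?_, hω2⟩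
    rw [map_cascade hb hab hC n z hd ω hω2, hω1]; norm_num
  | succ k ih =>
    intro z n hn ht0
    by_cases hd : a * LL μ θ Z 2 n z < b * LL μ θ Z 1 n z
    swap
    · exact dead z n hd
    have i1 := ih (Function.update z (n+1) 1) (n+1) (by omega) (by omega)
    have i2 := ih (Function.update z (n+1) 2) (n+1) (by omega) (by omega)
    have t1 := LL_two hb hab hC (i := 1) (by simp) n _ hd
    have t2 := LL_two hb hab hC (i := 2) (by simp) n _ hd
    have e1 := LL_split hC 1 n z
    have e2 := LL_split hC 2 n z
    simp only [signalProb] at t1 t2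
    norm_num at t1 t2
    set q := b / (a + b) * p (n + 1) with hqd
    have hρq : a / (a + b) * p (n + 1) = a / b * q := by rw [hqd]; field_simp
    rw [hρq] at t2
    have u1 : LL μ θ Z 1 (n+1) (Function.update z (n+1) 1) = LL μ θ Z 1 n z * (1 - q) := by
      linarith
    have u2 : LL μ θ Z 2 (n+1) (Function.update z (n+1) 1) = LL μ θ Z 2 n z * (1 - a / b * q) := by
      linarith
    have hQ : QQ a b p (n+1) = QQ a b p n + q := by
      rw [QQ, Finset.sum_range_succ, ← QQ]
    rw [u1, u2, hQ] at i1
    rw [t1, t2, hQ] at i2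
    have hp := hC.p_mem (n+1) (by omega)
    have hq0 : 0 ≤ q := mul_nonneg (by positivity) hp.1
    obtain ⟨m0, m1, m2, m3⟩ := hm q hq0 (hq n ht0)
    refine (pot_step hρ hA.le (LL_nonneg _ _ _) (LL_nonneg _ _ _) hq0 m0 m1 m2 m3).trans ?_
    refine (add_le_add i1 i2).trans (le_of_eq ?_)
    rw [← mul_add]
    congr 1
    rw [split_meas hC {ω | mapEst μ θ X Z (t+1) ω ≠ θ ω ∧ ∀ s ∈ Finset.Icc 1 n, Z s ω = z s}
      (Z (n+1)) (hC.Z_meas _) 1 2 (by norm_num) (Z_range hC _)]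
    simp only [Icc_step, Set.mem_ofPred_eq, and_assoc]

/-- Lemma 2(b). If the revealing probabilities satisfy
`limsup_{t→∞} t·p_t ≤ (1−ε)·((a+b)/b)·κ*(a,b)`, then
`P(MAP(Z_1,…,Z_{t-1},X_t) ≠ θ) = ω(1/t)`, i.e. `t·P(MAP(…) ≠ θ) → ∞`. -/
theorem map_error_little_omega (a b : ℝ) (hb : 0 < b) (hab : b < a)
    (ε : ℝ) (hε : 0 < ε) (p : ℕ → ℝ)
    (hp : Filter.limsup (fun t : ℕ => ENNReal.ofReal ((t : ℝ) * p t)) Filter.atTop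
      ≤ ENNReal.ofReal ((1 - ε) * ((a + b) / b) * kappaStar a b))
    {Ω : Type*} [MeasurableSpace Ω] (μ : Measure Ω) (θ : Ω → ℕ)
    (X I Z : ℕ → Ω → ℕ) (hC : IsCascade a b p μ θ X I Z) :
    Filter.Tendsto (fun t : ℕ => (t : ℝ) * mapErr μ θ X Z t) Filter.atTop
      Filter.atTop := by
  have := hC.prob
  have hρ : 1 < a / b := by rwa [one_lt_div hb]
  have hs : 0 < a + b := by linarith
  have hβ := bet_pos hρ
  have hkS : kappaStar a b = 1 / bet (a / b) := rfl
  have hkpos : 0 < kappaStar a b := by rw [hkS]; positivity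
  obtain ⟨e, he0, he1, hee⟩ : ∃ e : ℝ, 0 < e ∧ e < 1 ∧ e < ε :=
    ⟨min ε 1 / 2, by positivity, by linarith [min_le_right ε 1], by
      have := min_le_left ε 1
      linarith⟩
  set κ := (1 - e) * kappaStar a b with hκd
  have hκ : 0 < κ := mul_pos (by linarith) hkpos
  have hκβ : κ * bet (a / b) < 1 := by
    have : κ * bet (a / b) = 1 - e := by rw [hκd, hkS]; field_simp
    linarith
  obtain ⟨s0, s1, s2, τ, q0, h0, h01, h12, h2, hτ, hq0, hB, hm⟩ := exists_params hρ hκ hκβ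
  have hcoef : 0 < (a + b) / b := by positivity
  have hlt : ENNReal.ofReal ((1 - ε) * ((a + b) / b) * kappaStar a b)
      < ENNReal.ofReal (κ * ((a + b) / b)) := by
    refine (ENNReal.ofReal_lt_ofReal_iff (by positivity)).2 ?_
    have : 0 < ((a + b) / b) * kappaStar a b := by positivity
    rw [hκd]
    nlinarith
  have hev := eventually_lt_of_limsup_lt (hp.trans_lt hlt)
  have hev2 : ∀ᶠ t : ℕ in atTop, κ / q0 ≤ (t : ℝ) :=
    tendsto_natCast_atTop_atTop.eventually_ge_atTop _
  obtain ⟨T, hT⟩ := eventually_atTop.1 (hev.and hev2)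
  have hqn : ∀ n, T + 2 ≤ n → b / (a + b) * p (n + 1) ≤ κ / ((n : ℝ) + 1) := by
    intro n hn
    have h1 := (hT (n+1) (by omega)).1
    rw [ENNReal.ofReal_lt_ofReal_iff (by positivity)] at h1
    push_cast at h1
    rw [le_div_iff₀ (by positivity)]
    calc b / (a + b) * p (n + 1) * ((n : ℝ) + 1) = b / (a + b) * (((n : ℝ) + 1) * p (n + 1)) := by ring
      _ ≤ b / (a + b) * (κ * ((a + b) / b)) := by gcongr
      _ = κ := by field_simp
  have hqn0 : ∀ n, T + 2 ≤ n → b / (a + b) * p (n + 1) ≤ q0 := by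
    intro n hn
    refine (hqn n hn).trans ?_
    have h1 := (hT (n+1) (by omega)).2
    push_cast at h1
    rw [div_le_iff₀ hq0] at h1
    rw [div_le_iff₀ (by positivity)]
    linarith
  have hq1 : ∀ n, b / (a + b) * p (n + 1) ≤ 1 := by
    intro n
    have h1 := hC.p_mem (n+1) (by omega)
    have h3 : b / (a + b) ≤ 1 := by rw [div_le_one hs]; linarith
    exact mul_le_one₀ h3 h1.1 h1.2
  have hQ : ∀ n, T + 2 ≤ n → QQ a b p n ≤ ((T + 2 : ℕ) : ℝ) + κ * (harmonic n : ℚ) := by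
    intro n hn
    induction n, hn using Nat.le_induction with
    | base =>
      have h1 : QQ a b p (T + 2) ≤ ((T + 2 : ℕ) : ℝ) := by
        unfold QQ
        refine (Finset.sum_le_sum fun k _ => hq1 k).trans ?_
        simp
      have h3 : (0:ℝ) ≤ (harmonic (T+2) : ℚ) := by
        have : (0:ℚ) < harmonic (T+2) := harmonic_pos (by omega)
        exact_mod_cast this.le
      have := mul_nonneg hκ.le h3
      linarith
    | succ n hn ih =>
      rw [QQ, Finset.sum_range_succ, ← QQ, harmonic_succ]
      have := hqn n hn
      push_cast
      rw [div_eq_mul_inv κ] at this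
      push_cast at ih
      linarith
  obtain ⟨y0, x0⟩ := start hb hab hC T
  set x := LL μ θ Z 1 (T+2) (fun _ => 1) with hx
  set y := LL μ θ Z 2 (T+2) (fun _ => 1) with hy
  have hxn : 0 ≤ x := LL_nonneg _ _ _
  set E := Real.exp (bet (a / b) * QQ a b p (T+2)) with hE
  set F := Real.exp ((bet (a / b) - τ) * QQ a b p (T+2)) with hF
  have hEpos : 0 < E := Real.exp_pos _
  have hFpos : 0 < F := Real.exp_pos _
  have hD : 0 < E * (WW (a / b) s1 x y - WW (a / b) s0 x y) := by
    refine mul_pos hEpos (sub_pos.2 ?_)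
    rw [WW_eq hρ hxn y0, WW_eq hρ hxn y0]
    refine mul_lt_mul_of_pos_right (Real.rpow_lt_rpow_of_exponent_lt ?_ h01) y0
    rw [one_lt_div y0, lt_div_iff₀ (by linarith), mul_div_assoc', div_lt_iff₀ hb]
    linarith
  set D := E * (WW (a / b) s1 x y - WW (a / b) s0 x y) with hDd
  have hW2 := WW_nonneg (s := s2) hρ hxn y0.le
  obtain ⟨A, hA, hAD⟩ : ∃ A : ℝ, 0 < A ∧ A * F * WW (a / b) s2 x y < D := by
    refine ⟨D / (2 * (F * WW (a / b) s2 x y + 1)), by positivity, ?_⟩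
    have : 0 ≤ F * WW (a / b) s2 x y := by positivity
    rw [mul_assoc, div_mul_eq_mul_div, div_lt_iff₀ (by positivity)]
    nlinarith
  have hc : 0 < pot (a / b) s0 s1 s2 (bet (a / b)) τ A (QQ a b p (T+2)) x y := by
    unfold pot; linarith
  set c := pot (a / b) s0 s1 s2 (bet (a / b)) τ A (QQ a b p (T+2)) x y with hcd
  set B := bet (a / b) + τ * (s1 / (s2 - s1)) with hBd
  have hBpos : 0 < B := by
    have : 0 < s1 / (s2 - s1) := div_pos (by linarith) (by linarith)
    positivity
  have hmain : ∀ t, T + 2 ≤ t → c ≤ A⁻¹ ^ (s1 / (s2 - s1)) * Real.exp (B * QQ a b p t) *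
      mapErr μ θ X Z (t+1) := by
    intro t ht
    obtain ⟨k, rfl⟩ := Nat.exists_eq_add_of_le ht
    have := main_ind hb hab hC h0 h01 h12 h2 hA hm (T+2) (T+2+k) hqn0 k (fun _ => 1) (T+2) rfl le_rfl
    refine this.trans (mul_le_mul_of_nonneg_left ?_ (by positivity))
    exact ENNReal.toReal_mono (measure_ne_top _ _) (measure_mono fun ω h => h.1)
  set G := A⁻¹ ^ (s1 / (s2 - s1)) * Real.exp (B * (((T + 2 : ℕ) : ℝ) + κ)) with hG
  have hGpos : 0 < G := by positivity
  rw [← tendsto_add_atTop_iff_nat 1]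
  have hlim : Tendsto (fun t : ℕ => c / G * (t : ℝ) ^ (1 - κ * B)) atTop atTop :=
    ((tendsto_rpow_atTop (by linarith)).comp tendsto_natCast_atTop_atTop).const_mul_atTop
      (by positivity)
  refine tendsto_atTop_mono' _ ?_ hlim
  filter_upwards [eventually_ge_atTop (T+2)] with t ht
  have ht0 : (0:ℝ) < t := by
    have : 0 < t := by omega
    exact_mod_cast this
  have hQt : QQ a b p t ≤ ((T + 2 : ℕ) : ℝ) + κ + κ * Real.log t := by
    have h1 := hQ t ht
    have h3 := mul_le_mul_of_nonneg_left (harmonic_le_one_add_log t) hκ.le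
    linarith
  have hM : 0 ≤ mapErr μ θ X Z (t+1) := ENNReal.toReal_nonneg
  have h5 : c ≤ G * (t : ℝ) ^ (κ * B) * mapErr μ θ X Z (t+1) := by
    refine (hmain t ht).trans (mul_le_mul_of_nonneg_right ?_ hM)
    rw [hG, mul_assoc, Real.rpow_def_of_pos ht0, ← Real.exp_add]
    gcongr
    have := mul_le_mul_of_nonneg_left hQt hBpos.le
    linarith
  have hpw : (t : ℝ) ^ (1 - κ * B) * (t : ℝ) ^ (κ * B) = t := by
    rw [← Real.rpow_add ht0]; simp
  calc c / G * (t : ℝ) ^ (1 - κ * B)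
      ≤ (G * (t : ℝ) ^ (κ * B) * mapErr μ θ X Z (t+1)) / G * (t : ℝ) ^ (1 - κ * B) := by gcongr
    _ = ((t : ℝ) ^ (1 - κ * B) * (t : ℝ) ^ (κ * B)) * mapErr μ θ X Z (t+1) := by field_simp
    _ = t * mapErr μ θ X Z (t+1) := by rw [hpw]
    _ ≤ ((t + 1 : ℕ) : ℝ) * mapErr μ θ X Z (t+1) := by gcongr; push_cast; linarith
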